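/- Let 1 ≤ s < n, A ∈ Mat_{(s+1)×(n−s)}(ℝ) with first row a_0 ∈ ℝ^{n−s} and remaining rows A' ∈ Mat_{s×(n−s)}(ℝ), U ⊂ ℝ^s an open ball of radius r, and ψ : [0,∞) → [0,∞) non-increasing with Σ_ψ := Σ_{q ∈ ℤ^n∖{0}} ψ(‖q‖^n) < ∞. For κ > 0 and q ∈ ℤ^n∖{0} set L(q) := {x ∈ U : |p + (x, x̃A)·q| < κ ψ(‖q‖^n) for some p ∈ ℤ} and L_large(q) := {x ∈ L(q) : ‖[Id_s A'] q‖ ≥ √(ns‖q‖)/(2r)}. Then, with K_s := 4^{2s+1} s^{s/2} N_s / V_s (N_s the Besicovitch covering constant of ℝ^s, V_s the volume of the s-dimensional Euclidean unit ball), one has |L_large(q)| ≤ K_s κ ψ(‖q‖^n) |U| for every q ∈ ℤ^n∖{0}; consequently, for any ξ ∈ (0,1), if κ ≤ ξ/(2 K_s Σ_ψ) then Σ_{q ∈ ℤ^n∖{0}} |L_large(q)| ≤ (ξ/2)|U|. -/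

import Mathlib

open MeasureTheory Metric Set
open scoped BigOperators ENNReal

noncomputable section

/-- `x̃ = (1, x)` -/
def tilde {s : ℕ} (x : Fin s → ℝ) : Fin (s + 1) → ℝ := Fin.cons 1 x

/-- The parametrization `x ↦ (x, x̃A)` of the affine subspace. -/
def phiA {s m : ℕ} (A : Matrix (Fin (s + 1)) (Fin m) ℝ) (x : Fin s → ℝ) :
    Fin (s + m) → ℝ :=
  Fin.append x (Matrix.vecMul (tilde x) A)

/-- `(x, x̃A) · q + p`. -/
def dotA {s m : ℕ} (A : Matrix (Fin (s + 1)) (Fin m) ℝ) (x : Fin s → ℝ)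
    (q : Fin (s + m) → ℤ) : ℝ :=
  ∑ j, phiA A x j * (q j : ℝ)

/-- The gradient `[Id_s A'] q` of `x ↦ (x, x̃A)·q`. -/
def gradA {s m : ℕ} (A : Matrix (Fin (s + 1)) (Fin m) ℝ) (q : Fin (s + m) → ℤ) :
    Fin s → ℝ :=
  fun i => (q (Fin.castAdd m i) : ℝ) + ∑ j, A i.succ j * (q (Fin.natAdd s j) : ℝ)

/-- Coordinate `⟨e_i ∧ e_J, w⟩` of the map `c` (zero unless `J ⊆ {1,…,n}` and `i ∉ J`). -/
def cMap {n : ℕ} (w : Finset (Fin (n + 1)) → ℝ) (i : Fin (n + 1))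
    (J : Finset (Fin (n + 1))) : ℝ :=
  if (0 : Fin (n + 1)) ∈ J ∨ i ∈ J then 0
  else (-1 : ℝ) ^ (J.filter (· < i)).card * w (insert i J)

/-- The matrix `R_A = (Id_{s+1} | A)`. -/
def RA {s m : ℕ} (A : Matrix (Fin (s + 1)) (Fin m) ℝ) :
    Matrix (Fin (s + 1)) (Fin (s + m + 1)) ℝ :=
  fun a i =>
    if h : (i : ℕ) < s + 1 then (if (i : ℕ) = (a : ℕ) then 1 else 0)
    else A a ⟨(i : ℕ) - (s + 1), by omega⟩

/-- Coordinates of `R_A c(w)`. -/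
def RAc {s m : ℕ} (A : Matrix (Fin (s + 1)) (Fin m) ℝ)
    (w : Finset (Fin (s + m + 1)) → ℝ) (a : Fin (s + 1)) (J : Finset (Fin (s + m + 1))) : ℝ :=
  ∑ i, RA A a i * cMap w i J

/-- Euclidean norm of `R_A c(w)`. -/
def RAcNorm {s m : ℕ} (A : Matrix (Fin (s + 1)) (Fin m) ℝ)
    (w : Finset (Fin (s + m + 1)) → ℝ) : ℝ :=
  Real.sqrt (∑ a, ∑ J, (RAc A w a J) ^ 2)

/-- Euclidean norm of the projection `π_•(w)` onto `⋀(W_{s+1→n})`. -/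
def pibullNorm (s : ℕ) {n : ℕ} (w : Finset (Fin (n + 1)) → ℝ) : ℝ :=
  Real.sqrt (∑ S : Finset (Fin (n + 1)),
    if ∀ i ∈ S, s < (i : ℕ) then (w S) ^ 2 else 0)

/-- Euclidean norm of an exterior vector in coordinates. -/
def extNorm {N : ℕ} (w : Finset (Fin N) → ℝ) : ℝ :=
  Real.sqrt (∑ S : Finset (Fin N), (w S) ^ 2)

/-- Euclidean norm of the projection `π(w)` onto `⋀(W_{1→n})`. -/
def piNorm {n : ℕ} (w : Finset (Fin (n + 1)) → ℝ) : ℝ :=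
  Real.sqrt (∑ S : Finset (Fin (n + 1)),
    if (0 : Fin (n + 1)) ∉ S then (w S) ^ 2 else 0)

/-- `w` has pure degree `k`. -/
def ExtDeg {N : ℕ} (k : ℕ) (w : Finset (Fin N) → ℝ) : Prop :=
  ∀ S, S.card ≠ k → w S = 0

/-- The set of exponents `v` appearing in the definition of `ω_j(A)`. -/
def expSet (s m : ℕ) (A : Matrix (Fin (s + 1)) (Fin m) ℝ) (j : ℕ) : Set ℝ :=
  {v | 0 < v ∧ ∀ M : ℝ, ∃ w : Finset (Fin (s + m + 1)) → ℤ,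
    (∀ S, S.card ≠ j → w S = 0) ∧
    M < pibullNorm s (fun S => (w S : ℝ)) ∧
    RAcNorm A (fun S => (w S : ℝ)) <
      pibullNorm s (fun S => (w S : ℝ)) ^ (-(v + 1 - j) / j)}

/-- `ω_j(A) < n` for all `j = 1, …, n − s`  (here `n = s + m`). -/
def DiophCond (s m : ℕ) (A : Matrix (Fin (s + 1)) (Fin m) ℝ) : Prop :=
  ∀ j : ℕ, 1 ≤ j → j ≤ m → ∃ v : ℝ, v < (s + m : ℕ) ∧ ∀ u ∈ expSet s m A j, u ≤ v

/-- Action of a matrix on exterior coordinates (compound matrix action). -/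
def extAction {N : ℕ} (M : Matrix (Fin N) (Fin N) ℝ) (w : Finset (Fin N) → ℝ) :
    Finset (Fin N) → ℝ :=
  fun S => ∑ T : Finset (Fin N),
    if h : T.card = S.card then
      (Matrix.of fun a b : Fin S.card =>
          M (S.orderEmbOfFin rfl a) (T.orderEmbOfFin h b)).det * w T
    else 0

/-- The wedge `v_1 ∧ ⋯ ∧ v_k` of vectors, in coordinates. -/
def wedgeOf {N k : ℕ} (v : Fin k → (Fin N → ℝ)) : Finset (Fin N) → ℝ :=
  fun S =>
    if h : S.card = k then
      (Matrix.of fun a b : Fin k => v a (S.orderEmbOfFin h b)).det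
    else 0

/-- Sign for the wedge product of basis monomials. -/
def wedgeSign {N : ℕ} (T T' : Finset (Fin N)) : ℝ :=
  (-1) ^ (∑ a ∈ T, (T'.filter (· < a)).card)

/-- The wedge (exterior) product in coordinates. -/
def wedgeMul {N : ℕ} (u w : Finset (Fin N) → ℝ) : Finset (Fin N) → ℝ :=
  fun S => ∑ T ∈ S.powerset, wedgeSign T (S \ T) * u T * w (S \ T)

/-- The unipotent matrix `u_x` on `ℝ^{1+s+n}`, `n = s+m`, with block rows
`(1, 0, x, x̃A)`, `(0, I_s, I_s, A')`, `(0, 0, I_n)`. -/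
def uMat {s m : ℕ} (A : Matrix (Fin (s + 1)) (Fin m) ℝ) (x : Fin s → ℝ) :
    Matrix (Fin (1 + s + (s + m))) (Fin (1 + s + (s + m))) ℝ :=
  fun i j =>
    if (i : ℕ) = 0 then
      if (j : ℕ) = 0 then 1
      else if h1 : (j : ℕ) < 1 + s then 0
      else if h2 : (j : ℕ) < 1 + s + s then x ⟨(j : ℕ) - (1 + s), by omega⟩
      else ∑ a, tilde x a * A a ⟨(j : ℕ) - (1 + s + s), by have := j.isLt; omega⟩
    else if hi : (i : ℕ) < 1 + s then
      if (j : ℕ) = 0 then 0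
      else if h1 : (j : ℕ) < 1 + s then (if (j : ℕ) = (i : ℕ) then 1 else 0)
      else if h2 : (j : ℕ) < 1 + s + s then (if (j : ℕ) = (i : ℕ) + s then 1 else 0)
      else A ⟨(i : ℕ), by omega⟩ ⟨(j : ℕ) - (1 + s + s), by have := j.isLt; omega⟩
    else if j = i then 1 else 0

/-- The diagonal matrix `g_t = diag(ε/δ, ε/K, …, ε/K, ε/T, …, ε/T)` on `ℝ^{1+s+n}`. -/
def gMat (s m : ℕ) (δ K T ε : ℝ) :
    Matrix (Fin (1 + s + (s + m))) (Fin (1 + s + (s + m))) ℝ :=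
  Matrix.diagonal fun i =>
    if (i : ℕ) = 0 then ε / δ else if (i : ℕ) < 1 + s then ε / K else ε / T

/-- The vector `(p, 0, …, 0, q) ∈ Λ ⊂ ℤ^{1+s+n}`. -/
def lamVec (s m : ℕ) (p : ℤ) (q : Fin (s + m) → ℤ) : Fin (1 + s + (s + m)) → ℝ :=
  fun i =>
    if (i : ℕ) = 0 then (p : ℝ)
    else if h : (i : ℕ) < 1 + s then 0
    else (q ⟨(i : ℕ) - (1 + s), by have := i.isLt; omega⟩ : ℝ)

/-- The matrix `ũ_x` on `ℝ^{n+1}`, with block rows `(1, x, x̃A)` and `(0, I_n)`. -/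
def utMat {s m : ℕ} (A : Matrix (Fin (s + 1)) (Fin m) ℝ) (x : Fin s → ℝ) :
    Matrix (Fin (s + m + 1)) (Fin (s + m + 1)) ℝ :=
  fun i j =>
    if (i : ℕ) = 0 then
      if h : (j : ℕ) = 0 then 1
      else phiA A x ⟨(j : ℕ) - 1, by have := j.isLt; omega⟩
    else if j = i then 1 else 0

/-- The diagonal matrix `g̃_t = diag(ε/δ, ε/T, …, ε/T)` on `ℝ^{n+1}`. -/
def gtMat (s m : ℕ) (δ T ε : ℝ) : Matrix (Fin (s + m + 1)) (Fin (s + m + 1)) ℝ :=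
  Matrix.diagonal fun i => if (i : ℕ) = 0 then ε / δ else ε / T

/-- The function `ν(w) = ‖π_*(w)‖`: the euclidean norm of the part of `w` involving at most
one of the starred basis vectors `e_{*1}, …, e_{*s}` (indices `1, …, s` of `ℝ^{1+s+n}`). -/
def nuFun (s m : ℕ) (w : Finset (Fin (1 + s + (s + m))) → ℝ) : ℝ :=
  Real.sqrt (∑ S : Finset (Fin (1 + s + (s + m))),
    if (S.filter fun i : Fin (1 + s + (s + m)) => 1 ≤ (i : ℕ) ∧ (i : ℕ) < 1 + s).card ≤ 1
    then (w S) ^ 2 else 0)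

/-- `δ := κ/2^{nt}`. -/
def deltaP (s m : ℕ) (κ : ℝ) (t : ℕ) : ℝ := κ / 2 ^ ((s + m) * t)

/-- `K := √(ns/(2r²))·2^{t/2}`. -/
def KofT (s m : ℕ) (r : ℝ) (t : ℕ) : ℝ :=
  Real.sqrt (((s + m : ℕ) : ℝ) * s / (2 * r ^ 2)) * 2 ^ ((t : ℝ) / 2)

/-- `T := 2^{t+1}`. -/
def TofT (t : ℕ) : ℝ := 2 ^ (t + 1)

/-- `ε' := (δKT^{n−1})^{1/(n+1)}`. -/
def epsP' (s m : ℕ) (κ r : ℝ) (t : ℕ) : ℝ :=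
  (deltaP s m κ t * KofT s m r t * TofT t ^ (s + m - 1)) ^ (1 / ((s + m : ℕ) + 1 : ℝ))

/-- `ε := 2^{βt} ε'`. -/
def epsP (s m : ℕ) (κ r β : ℝ) (t : ℕ) : ℝ :=
  (2 : ℝ) ^ (β * t) * epsP' s m κ r t

/-- `‖ỹ c(w)‖` where `ỹ = (1, x, x̃A) = x̃ R_A`. -/
def ycNorm {s m : ℕ} (A : Matrix (Fin (s + 1)) (Fin m) ℝ) (x : Fin s → ℝ)
    (w : Finset (Fin (s + m + 1)) → ℝ) : ℝ :=
  Real.sqrt (∑ J : Finset (Fin (s + m + 1)),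
    (∑ i, (Fin.cons (1 : ℝ) (phiA A x) : Fin (s + m + 1) → ℝ) i * cMap w i J) ^ 2)

/-- A function is `(C, α)`-good on `V ⊆ ℝ^s`. -/
def IsGood (s : ℕ) (C α : ℝ) (f : EuclideanSpace ℝ (Fin s) → ℝ)
    (V : Set (EuclideanSpace ℝ (Fin s))) : Prop :=
  ∀ (y₀ : EuclideanSpace ℝ (Fin s)) (r : ℝ), 0 < r → ball y₀ r ⊆ V →
    ∀ ε : ℝ, 0 < ε →
      volume {x ∈ ball y₀ r | |f x| < ε} ≤
        ENNReal.ofReal (C * (ε / sSup ((fun y => |f y|) '' ball y₀ r)) ^ α) *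
          volume (ball y₀ r)

/-- `V_s`: the volume of the `s`-dimensional euclidean unit ball. -/
def Vball (s : ℕ) : ℝ := (volume (ball (0 : EuclideanSpace ℝ (Fin s)) 1)).toReal

/-- `N_s`: the Besicovitch covering constant of `ℝ^s`. -/
def Nbes (s : ℕ) : ℕ := Besicovitch.multiplicity (EuclideanSpace ℝ (Fin s))

/-- `K_s := 4^{2s+1} s^{s/2} N_s / V_s`. -/
def Kcst (s : ℕ) : ℝ :=
  4 ^ (2 * s + 1) * (s : ℝ) ^ ((s : ℝ) / 2) * (Nbes s : ℝ) / Vball s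

/-- `Γ` is a primitive subgroup of `Λ`: `Γ ≤ Λ` and `Γ_ℝ ∩ Λ = Γ`. -/
def IsPrimitiveIn {d : ℕ} (Λ Γ : Submodule ℤ (Fin d → ℝ)) : Prop :=
  Γ ≤ Λ ∧
    (Submodule.span ℝ (Γ : Set (Fin d → ℝ))).restrictScalars ℤ ⊓ Λ = Γ

/-- `u` is a basis of the discrete subgroup `Γ` (so `u₁ ∧ ⋯ ∧ u_j` represents `Γ`). -/
def Represents {d j : ℕ} (u : Fin j → (Fin d → ℝ)) (Γ : Submodule ℤ (Fin d → ℝ)) : Prop :=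
  LinearIndependent ℝ u ∧ Submodule.span ℤ (Set.range u) = Γ

/-- `w = v₁ ∧ ⋯ ∧ v_k` represents the nonzero primitive rank-`k` subgroup of `ℤ^N`
generated by `v₁, …, v_k`. -/
def RepresentsPrimInt {N k : ℕ} (v : Fin k → (Fin N → ℤ)) (w : Finset (Fin N) → ℝ) : Prop :=
  LinearIndependent ℝ (fun a => fun i => ((v a i : ℝ))) ∧
  (∀ z : Fin N → ℤ,
      ((fun i => (z i : ℝ)) ∈
        Submodule.span ℝ (Set.range fun a => fun i => ((v a i : ℝ)))) →
      z ∈ Submodule.span ℤ (Set.range v)) ∧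
  w = wedgeOf fun a => fun i => ((v a i : ℝ))

/-- The points of an interval of length `2r` at which an affine function of slope `g` is within `δ`
of an integer form a set of measure at most `4rδ + 4δ/|g|`. -/
theorem volume_affine_near_int_le (a r g b δ : ℝ) (hr : 0 < r) (hg : g ≠ 0) (hδ : 0 ≤ δ) :
    volume {t : ℝ | t ∈ ball a r ∧ ∃ p : ℤ, |(p : ℝ) + (b + g * t)| < δ} ≤
      ENNReal.ofReal (4 * r * δ + 4 * δ / |g|) := by
  have hg' : 0 < |g| := abs_pos.mpr hg
  rcases le_or_gt δ (1 / 2) with h | h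
  · set lo : ℤ := ⌈-b - g * a - |g| * r - δ⌉
    set hi : ℤ := ⌊-b - g * a + |g| * r + δ⌋
    have hcover : {t : ℝ | t ∈ ball a r ∧ ∃ p : ℤ, |(p : ℝ) + (b + g * t)| < δ} ⊆
        ⋃ p ∈ Finset.Icc lo hi, ball (-((p : ℝ) + b) / g) (δ / |g|) := by
      rintro t ⟨ht, p, hp⟩
      rw [mem_ball, Real.dist_eq] at ht
      have hgt : |g * (t - a)| ≤ |g| * r := by
        rw [abs_mul]; gcongr
      rw [abs_le] at hgt
      have hp' := abs_lt.mp hp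
      simp only [mem_iUnion]
      refine ⟨p, ?_, ?_⟩
      · rw [Finset.mem_Icc, Int.ceil_le, Int.le_floor]
        constructor <;> linarith [hgt.1, hgt.2, hp'.1, hp'.2]
      · have : (t - -((p : ℝ) + b) / g) * g = p + (b + g * t) := by
          rw [sub_mul, div_mul_cancel₀ _ hg]
          ring
        rwa [mem_ball, Real.dist_eq, lt_div_iff₀ hg', ← abs_mul, this]
    have hcard : ((Finset.Icc lo hi).card : ℝ) ≤ 2 * |g| * r + 2 := by
      have hlo : -b - g * a - |g| * r - δ ≤ (lo : ℝ) := Int.le_ceil _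
      have hhi : (hi : ℝ) ≤ -b - g * a + |g| * r + δ := Int.floor_le _
      rw [Int.card_Icc]
      rcases le_total 0 (hi + 1 - lo) with h0 | h0
      · have : (((hi + 1 - lo).toNat : ℤ) : ℝ) = ((hi + 1 - lo : ℤ) : ℝ) := by
          rw [Int.toNat_of_nonneg h0]
        rw [Int.cast_natCast] at this
        rw [this]
        push_cast
        linarith
      · rw [Int.toNat_of_nonpos h0]
        simp only [Nat.cast_zero]
        positivity
    calc _ ≤ _ := measure_mono hcover
      _ ≤ ∑ p ∈ Finset.Icc lo hi, volume (ball (-((p : ℝ) + b) / g) (δ / |g|)) :=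
        measure_biUnion_finset_le _ _
      _ = ENNReal.ofReal ((Finset.Icc lo hi).card * (2 * (δ / |g|))) := by
        simp only [Real.volume_ball, Finset.sum_const, nsmul_eq_mul]
        rw [ENNReal.ofReal_mul (Nat.cast_nonneg _), ENNReal.ofReal_natCast]
      _ ≤ _ := by
        apply ENNReal.ofReal_le_ofReal
        calc _ ≤ (2 * |g| * r + 2) * (2 * (δ / |g|)) := by gcongr
          _ = _ := by field_simp; ring
  · calc _ ≤ volume (ball a r) := measure_mono fun t ht => ht.1
      _ = ENNReal.ofReal (2 * r) := Real.volume_ball _ _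
      _ ≤ _ := by
        apply ENNReal.ofReal_le_ofReal
        have : 0 ≤ 4 * δ / |g| := by positivity
        nlinarith

/-- The points of a cube of side `2r` at which an affine function whose gradient has a nonzero
`i`-th coordinate `g i` is within `δ` of an integer form a set of measure at most
`(4rδ + 4δ/|g i|)(2r)^k`. -/
theorem volume_pi_affine_near_int_le {k : ℕ} (a : Fin (k + 1) → ℝ) (r : ℝ) (g : Fin (k + 1) → ℝ)
    (b δ : ℝ) (i : Fin (k + 1)) (hr : 0 < r) (hg : g i ≠ 0) (hδ : 0 ≤ δ) :
    volume {x : Fin (k + 1) → ℝ |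
        x ∈ ball a r ∧ ∃ p : ℤ, |(p : ℝ) + (b + ∑ j, g j * x j)| < δ} ≤
      ENNReal.ofReal ((4 * r * δ + 4 * δ / |g i|) * (2 * r) ^ k) := by
  set E := {x : Fin (k + 1) → ℝ |
    x ∈ ball a r ∧ ∃ p : ℤ, |(p : ℝ) + (b + ∑ j, g j * x j)| < δ}
  have hE : MeasurableSet E := by
    have : E = ball a r ∩ ⋃ p : ℤ, {x | |(p : ℝ) + (b + ∑ j, g j * x j)| < δ} := by
      ext
      simp only [E, mem_ofPred_eq, mem_inter_iff, mem_iUnion]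
    rw [this]
    exact measurableSet_ball.inter (isOpen_iUnion fun p =>
      isOpen_lt (by fun_prop) continuous_const).measurableSet
  have hmp := (volume_preserving_piFinSuccAbove (fun _ : Fin (k + 1) => ℝ) i).symm
  rw [← hmp.measure_preimage hE.nullMeasurableSet, Measure.volume_eq_prod,
    Measure.prod_apply_symm (hmp.measurable hE)]
  have hbound : ∀ y : Fin k → ℝ,
      volume ((fun t : ℝ => (t, y)) ⁻¹'
        ((MeasurableEquiv.piFinSuccAbove (fun _ : Fin (k + 1) => ℝ) i).symm ⁻¹' E)) ≤
      (ball (fun j => a (i.succAbove j)) r).indicator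
        (fun _ => ENNReal.ofReal (4 * r * δ + 4 * δ / |g i|)) y := by
    intro y
    have hsub : ((fun t : ℝ => (t, y)) ⁻¹'
        ((MeasurableEquiv.piFinSuccAbove (fun _ : Fin (k + 1) => ℝ) i).symm ⁻¹' E)) ⊆
        {t | (t ∈ ball (a i) r ∧ ∃ p : ℤ,
            |(p : ℝ) + ((b + ∑ j, g (i.succAbove j) * y j) + g i * t)| < δ) ∧
          y ∈ ball (fun j => a (i.succAbove j)) r} := by
      intro t ht
      have hins : (MeasurableEquiv.piFinSuccAbove (fun _ : Fin (k + 1) => ℝ) i).symm (t, y) =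
        i.insertNth t y := rfl
      rw [mem_preimage, mem_preimage, hins] at ht
      obtain ⟨ht, p, hp⟩ := ht
      rw [mem_ball, dist_pi_lt_iff hr] at ht
      rw [Fin.sum_univ_succAbove _ i] at hp
      simp only [Fin.insertNth_apply_same, Fin.insertNth_apply_succAbove] at hp
      refine ⟨⟨?_, p, ?_⟩, ?_⟩
      · simpa using ht i
      · convert hp using 2
        ring
      · rw [mem_ball, dist_pi_lt_iff hr]
        intro j
        simpa using ht (i.succAbove j)
    by_cases hy : y ∈ ball (fun j => a (i.succAbove j)) r
    · rw [indicator_of_mem hy]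
      exact (measure_mono fun t ht => (hsub ht).1).trans
        (volume_affine_near_int_le _ _ _ _ _ hr hg hδ)
    · rw [indicator_of_notMem hy]
      exact (measure_mono fun t ht => hy (hsub ht).2 : _ ≤ volume (∅ : Set ℝ)).trans (by simp)
  refine (lintegral_mono hbound).trans ?_
  rw [lintegral_indicator_const measurableSet_ball, Real.volume_pi_ball _ hr, Fintype.card_fin,
    ← ENNReal.ofReal_mul (by positivity)]

theorem dotA_eq {s m : ℕ} (A : Matrix (Fin (s + 1)) (Fin m) ℝ) (x : Fin s → ℝ)
    (q : Fin (s + m) → ℤ) :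
    dotA A x q = ∑ j, A 0 j * (q (Fin.natAdd s j) : ℝ) + ∑ i, gradA A q i * x i := by
  simp only [dotA, phiA, gradA, Fin.sum_univ_add, Fin.append_left, Fin.append_right,
    Matrix.vecMul, dotProduct, tilde, Fin.sum_univ_succ, Fin.cons_zero, Fin.cons_succ, one_mul,
    add_mul, Finset.sum_add_distrib, Finset.sum_mul]
  rw [Finset.sum_comm]
  have h : ∀ i j, x i * A i.succ j * (q (Fin.natAdd s j) : ℝ) =
    A i.succ j * (q (Fin.natAdd s j) : ℝ) * x i := fun i j => by ring
  simp only [h]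
  simp only [mul_comm (x _)]
  ring

theorem one_le_Nbes (s : ℕ) : 1 ≤ Nbes s := by
  have := Besicovitch.card_le_multiplicity (E := EuclideanSpace ℝ (Fin s)) (s := {0})
    (by simp) (by simp)
  rwa [Finset.card_singleton] at this

theorem Vball_pos (s : ℕ) : 0 < Vball s :=
  ENNReal.toReal_pos (measure_ball_pos _ _ one_pos).ne' measure_ball_lt_top.ne

theorem Kcst_mul_Vball (s : ℕ) :
    Kcst s * Vball s = 4 ^ (2 * s + 1) * (s : ℝ) ^ ((s : ℝ) / 2) * (Nbes s : ℝ) :=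
  div_mul_cancel₀ _ (Vball_pos s).ne'

theorem four_pow_le_Kcst_mul_Vball {s : ℕ} (hs : 1 ≤ s) :
    4 ^ (2 * s + 1) ≤ Kcst s * Vball s := by
  rw [Kcst_mul_Vball]
  have h1 : (1 : ℝ) ≤ (s : ℝ) ^ ((s : ℝ) / 2) :=
    Real.one_le_rpow (by exact_mod_cast hs) (by positivity)
  have h2 : (1 : ℝ) ≤ Nbes s := by exact_mod_cast one_le_Nbes s
  rw [mul_assoc]
  exact le_mul_of_one_le_right (by positivity) (one_le_mul_of_one_le_of_one_le h1 h2)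

theorem Kcst_pos {s : ℕ} (hs : 1 ≤ s) : 0 < Kcst s :=
  pos_of_mul_pos_left ((by positivity : (0 : ℝ) < 4 ^ (2 * s + 1)).trans_le
    (four_pow_le_Kcst_mul_Vball hs)) (Vball_pos s).le

theorem volume_ball_eq_Vball {s : ℕ} (x₀ : EuclideanSpace ℝ (Fin s)) {r : ℝ} (hr : 0 < r) :
    volume (ball x₀ r) = ENNReal.ofReal (r ^ s * Vball s) := by
  rw [Measure.addHaar_ball_of_pos _ _ hr, finrank_euclideanSpace_fin,
    ENNReal.ofReal_mul (by positivity), Vball, ENNReal.ofReal_toReal measure_ball_lt_top.ne]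

theorem one_le_norm_int_pi {n : ℕ} {q : Fin n → ℤ} (hq : q ≠ 0) : 1 ≤ ‖q‖ := by
  obtain ⟨i, hi⟩ := Function.ne_iff.mp hq
  refine le_trans ?_ (norm_le_pi_norm q i)
  rw [Int.norm_eq_abs]
  exact_mod_cast Int.one_le_abs hi

/-- The points of a ball of radius `r` where `(x, x̃A)·q` is within `δ` of an integer, when the
gradient is large, form a set of measure at most `K_s δ |U|`. -/
theorem volume_near_int_of_large_grad_le {s m : ℕ} (hs : 1 ≤ s)
    (A : Matrix (Fin (s + 1)) (Fin m) ℝ) (x₀ : EuclideanSpace ℝ (Fin s)) {r : ℝ} (hr : 0 < r)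
    {δ : ℝ} (hδ : 0 ≤ δ) {q : Fin (s + m) → ℤ} (hq : q ≠ 0)
    (hlarge : Real.sqrt ((((s + m) * s : ℕ) : ℝ) * ‖q‖) / (2 * r) ≤ ‖gradA A q‖) :
    volume {x ∈ ball x₀ r | ∃ p : ℤ, |(p : ℝ) + dotA A (fun i => x i) q| < δ} ≤
      ENNReal.ofReal (Kcst s * δ) * volume (ball x₀ r) := by
  obtain ⟨k, rfl⟩ : ∃ k, s = k + 1 := ⟨s - 1, by omega⟩
  obtain ⟨i, hi⟩ : ∃ i, ‖gradA A q‖ = ‖gradA A q i‖ := by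
    obtain ⟨i, -, hi⟩ := Finset.exists_max_image Finset.univ (fun i => ‖gradA A q i‖)
      Finset.univ_nonempty
    exact ⟨i, le_antisymm ((pi_norm_le_iff_of_nonneg (norm_nonneg _)).mpr fun j =>
      hi j (Finset.mem_univ j)) (norm_le_pi_norm _ i)⟩
  have hlow : 1 / (2 * r) ≤ |gradA A q i| := by
    rw [← Real.norm_eq_abs, ← hi]
    refine le_trans ?_ hlarge
    gcongr
    rw [Real.one_le_sqrt]
    have : (1 : ℝ) ≤ ((k + 1 + m) * (k + 1) : ℕ) := by
      exact_mod_cast Nat.one_le_iff_ne_zero.mpr (by positivity)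
    exact one_le_mul_of_one_le_of_one_le this (one_le_norm_int_pi hq)
  have hpos : 0 < |gradA A q i| := lt_of_lt_of_le (by positivity) hlow
  have hinv : 1 / |gradA A q i| ≤ 2 * r := by
    rw [div_le_iff₀ hpos]
    rw [div_le_iff₀ (by positivity)] at hlow
    linarith
  have hsub : {x ∈ ball x₀ r | ∃ p : ℤ, |(p : ℝ) + dotA A (fun i => x i) q| < δ} ⊆
      (MeasurableEquiv.toLp 2 (Fin (k + 1) → ℝ)).symm ⁻¹' {x : Fin (k + 1) → ℝ |
        x ∈ ball (fun i => x₀ i) r ∧ ∃ p : ℤ, |(p : ℝ) +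
          (∑ j, A 0 j * (q (Fin.natAdd (k + 1) j) : ℝ) + ∑ j, gradA A q j * x j)| < δ} := by
    rintro x ⟨hx, p, hp⟩
    refine ⟨?_, p, ?_⟩
    · change (fun i => x i) ∈ _
      rw [mem_ball, dist_pi_lt_iff hr]
      intro j
      rw [mem_ball, dist_eq_norm] at hx
      rw [dist_eq_norm]
      exact (PiLp.norm_apply_le (x - x₀) j).trans_lt hx
    · rwa [dotA_eq] at hp
  refine (measure_mono hsub).trans ?_
  rw [(EuclideanSpace.volume_preserving_symm_measurableEquiv_toLp
    (Fin (k + 1))).measure_preimage_equiv]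
  refine (volume_pi_affine_near_int_le _ r _ _ δ i hr (abs_pos.mp hpos) hδ).trans ?_
  rw [volume_ball_eq_Vball x₀ hr,
    ← ENNReal.ofReal_mul (mul_nonneg (Kcst_pos hs).le hδ)]
  apply ENNReal.ofReal_le_ofReal
  have hpow : (12 : ℝ) * 2 ^ k ≤ 4 ^ (2 * (k + 1) + 1) := by
    have h2 : (2 : ℝ) ^ k ≤ 16 ^ k := by gcongr; norm_num
    have h4 : (4 : ℝ) ^ (2 * (k + 1) + 1) = 64 * 16 ^ k := by
      rw [show (16 : ℝ) = 4 ^ 2 by norm_num, ← pow_mul]; ring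
    have : (0 : ℝ) ≤ 16 ^ k := by positivity
    linarith
  calc (4 * r * δ + 4 * δ / |gradA A q i|) * (2 * r) ^ k
      = (4 * r * δ + 4 * δ * (1 / |gradA A q i|)) * (2 * r) ^ k := by ring
    _ ≤ (4 * r * δ + 4 * δ * (2 * r)) * (2 * r) ^ k := by gcongr
    _ = 12 * 2 ^ k * (δ * r ^ (k + 1)) := by ring
    _ ≤ Kcst (k + 1) * Vball (k + 1) * (δ * r ^ (k + 1)) := by
      exact mul_le_mul_of_nonneg_right (hpow.trans (four_pow_le_Kcst_mul_Vball hs))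
        (by positivity)
    _ = _ := by ring

/-- If `μ i ≤ K κ f i B` for all `i` and `κ ≤ ξ / (2 K ∑ f)`, then `∑ μ ≤ (ξ/2) B`. -/
theorem tsum_le_half_mul_of_le {ι : Type*} {f : ι → ℝ} (hf : ∀ i, 0 ≤ f i) (hsum : Summable f)
    {μ : ι → ℝ≥0∞} {K κ ξ : ℝ} (hK : 0 < K) (hκ : 0 < κ) {B : ℝ≥0∞}
    (hμ : ∀ i, μ i ≤ ENNReal.ofReal (K * κ * f i) * B) (hle : κ ≤ ξ / (2 * K * ∑' i, f i)) :
    ∑' i, μ i ≤ ENNReal.ofReal (ξ / 2) * B := by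
  have hS : 0 < ∑' i, f i := by
    refine (tsum_nonneg hf).lt_of_ne fun h => ?_
    rw [← h, mul_zero, div_zero] at hle
    exact hκ.not_ge hle
  refine (ENNReal.tsum_le_tsum hμ).trans ?_
  rw [ENNReal.tsum_mul_right, ← ENNReal.ofReal_tsum_of_nonneg
    (fun i => mul_nonneg (by positivity) (hf i)) (hsum.mul_left _), tsum_mul_left]
  gcongr
  rw [le_div_iff₀ (by positivity)] at hle
  linarith

/-- Estimate for the measure of `L_large(q)`, and the resulting summed bound
(here `n = s + m`). -/
theorem Llarge_estimate (s m : ℕ) (hs : 1 ≤ s) (hm : 1 ≤ m)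
    (A : Matrix (Fin (s + 1)) (Fin m) ℝ)
    (x₀ : EuclideanSpace ℝ (Fin s)) (r : ℝ) (hr : 0 < r)
    (ψ : ℝ → ℝ) (hmono : AntitoneOn ψ (Ici 0)) (hnn : ∀ x ∈ Ici (0 : ℝ), 0 ≤ ψ x)
    (hsum : Summable fun q : {q : Fin (s + m) → ℤ // q ≠ 0} => ψ (‖q.1‖ ^ (s + m)))
    (κ : ℝ) (hκ : 0 < κ) :
    ∃ Ks > (0 : ℝ), Ks = Kcst s ∧
      (∀ q : Fin (s + m) → ℤ, q ≠ 0 →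
        volume {x ∈ ball x₀ r |
            (∃ p : ℤ, |(p : ℝ) + dotA A (fun i => x i) q| < κ * ψ (‖q‖ ^ (s + m))) ∧
            Real.sqrt ((((s + m) * s : ℕ) : ℝ) * ‖q‖) / (2 * r) ≤ ‖gradA A q‖} ≤
          ENNReal.ofReal (Ks * κ * ψ (‖q‖ ^ (s + m))) * volume (ball x₀ r)) ∧
      (∀ ξ ∈ Ioo (0 : ℝ) 1,
        κ ≤ ξ / (2 * Ks * ∑' q : {q : Fin (s + m) → ℤ // q ≠ 0}, ψ (‖q.1‖ ^ (s + m))) →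
        (∑' q : {q : Fin (s + m) → ℤ // q ≠ 0},
          volume {x ∈ ball x₀ r |
            (∃ p : ℤ, |(p : ℝ) + dotA A (fun i => x i) q.1| < κ * ψ (‖q.1‖ ^ (s + m))) ∧
            Real.sqrt ((((s + m) * s : ℕ) : ℝ) * ‖q.1‖) / (2 * r) ≤ ‖gradA A q.1‖}) ≤
          ENNReal.ofReal (ξ / 2) * volume (ball x₀ r)) := by
  have hψ : ∀ q : Fin (s + m) → ℤ, 0 ≤ ψ (‖q‖ ^ (s + m)) := fun q =>
    hnn _ (mem_Ici.mpr (by positivity))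
  have hK := Kcst_pos hs
  have hmeas : ∀ q : Fin (s + m) → ℤ, q ≠ 0 →
      volume {x ∈ ball x₀ r |
          (∃ p : ℤ, |(p : ℝ) + dotA A (fun i => x i) q| < κ * ψ (‖q‖ ^ (s + m))) ∧
          Real.sqrt ((((s + m) * s : ℕ) : ℝ) * ‖q‖) / (2 * r) ≤ ‖gradA A q‖} ≤
        ENNReal.ofReal (Kcst s * κ * ψ (‖q‖ ^ (s + m))) * volume (ball x₀ r) := by
    intro q hq
    by_cases hl : Real.sqrt ((((s + m) * s : ℕ) : ℝ) * ‖q‖) / (2 * r) ≤ ‖gradA A q‖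
    · rw [mul_assoc]
      exact (measure_mono fun x hx => And.intro hx.1 hx.2.1).trans
        (volume_near_int_of_large_grad_le hs A x₀ hr (mul_nonneg hκ.le (hψ q)) hq hl)
    · simp only [hl, and_false, ofPred_false, measure_empty, zero_le]
  refine ⟨Kcst s, hK, rfl, hmeas, ?_⟩
  intro ξ _ hle
  have hf : ∀ q : {q : Fin (s + m) → ℤ // q ≠ 0}, 0 ≤ ψ (‖q.1‖ ^ (s + m)) := fun q => hψ q.1
  refine tsum_le_half_mul_of_le hf hsum hK hκ ?_ hle
  rintro ⟨q, hq⟩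
  exact hmeas q hq

end
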